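/- arXiv:2004.11770 — 2 statements merged into one kernel-verified Lean document; each statement's English description precedes it below -/
import Mathlib

section
/- Let β ∈ (0,2) and let F be a probability measure on ℝ^d with finite β-th moment whose coordinate marginals F₁,…,F_d are continuous, unimodal and symmetric with respect to μ₁,…,μ_d respectively. Then for every y ∈ ℝ^d, S_β(F,y) ≥ S_β(F⁺,μ), where μ = (μ₁,…,μ_d) and F⁺ is the comonotone distribution, i.e., the law of (F₁⁻¹(U),…,F_d⁻¹(U)) for U uniform on (0,1) with F_i⁻¹ the quantile functions. -/
open MeasureTheory Set

/-- The Euclidean distance `‖x - y‖₂` on `ℝ^d`. -/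
noncomputable def dist2 {d : ℕ} (x y : Fin d → ℝ) : ℝ := Real.sqrt (∑ i, (x i - y i) ^ 2)

/-- `S_β(F,y) = ∫ ‖x-y‖₂^β F(dx)` for an observation `y`. -/
noncomputable def SbY (d : ℕ) (β : ℝ) (F : Measure (Fin d → ℝ)) (y : Fin d → ℝ) : ℝ :=
  ∫ x, dist2 x y ^ β ∂F

/-- The Euclidean norm `‖x‖₂` on `ℝ^d`. -/
noncomputable def euclNorm {d : ℕ} (x : Fin d → ℝ) : ℝ := Real.sqrt (∑ i, (x i) ^ 2)

/-- The cdf of the `i`-th coordinate marginal of `F`. -/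
noncomputable def margCdf (d : ℕ) (F : Measure (Fin d → ℝ)) (i : Fin d) (t : ℝ) : ℝ :=
  ((Measure.map (fun x => x i) F) (Set.Iic t)).toReal

/-- The quantile function (generalized inverse) of the `i`-th marginal cdf of `F`. -/
noncomputable def margQuantile (d : ℕ) (F : Measure (Fin d → ℝ)) (i : Fin d) (u : ℝ) : ℝ :=
  sInf {t : ℝ | u ≤ margCdf d F i t}

/-- The comonotone distribution `F⁺` with the same marginals as `F`: the law of
`(F₁⁻¹(U),…,F_d⁻¹(U))` for `U` uniform on `(0,1)`. -/
noncomputable def comonotone (d : ℕ) (F : Measure (Fin d → ℝ)) : Measure (Fin d → ℝ) :=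
  Measure.map (fun u : ℝ => fun i : Fin d => margQuantile d F i u)
    (volume.restrict (Set.Ioo 0 1))

theorem aux_cc {G : ℝ → ℝ} {m : ℝ} (hconc : ConcaveOn ℝ (Ici m) G) {x y a b : ℝ}
    (hx : x ∈ Ici m) (hy : y ∈ Ici m) (ha : 0 ≤ a) (hb : 0 ≤ b) (hab : a + b = 1) :
    a * G x + b * G y ≤ G (a * x + b * y) := by
  simpa using hconc.2 hx hy ha hb hab

theorem aux_sym0 {G : ℝ → ℝ} {m : ℝ} (hc : Continuous G)
    (hs : ∀ t > 0, G (m + t) + G (m - t) = 1) (t : ℝ) : G (m + t) + G (m - t) = 1 := by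
  rcases lt_trichotomy t 0 with h | h | h
  · have := hs (-t) (by linarith)
    rw [sub_neg_eq_add, ← sub_eq_add_neg] at this
    linarith
  · subst h
    have h1 : Set.EqOn (fun t => G (m + t) + G (m - t)) (fun _ => 1) (closure (Ioi (0:ℝ))) :=
      Set.EqOn.closure (fun t ht => hs t ht) (by fun_prop) (by fun_prop)
    exact h1 (by simp)
  · exact hs t h

theorem aux_subadd {G : ℝ → ℝ} {m : ℝ} (hconc : ConcaveOn ℝ (Ici m) G) {x y : ℝ}
    (hx : 0 ≤ x) (hy : 0 ≤ y) : G (m + (x + y)) + G m ≤ G (m + x) + G (m + y) := by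
  rcases (add_nonneg hx hy).eq_or_lt with h | h
  · have hx0 : x = 0 := by linarith
    have hy0 : y = 0 := by linarith
    subst hx0; subst hy0; simp
  · have hne := h.ne'
    have h1 := aux_cc hconc (x := m) (y := m + (x + y)) (by simp) (by simp [h.le])
      (a := y / (x + y)) (b := x / (x + y)) (by positivity) (by positivity)
      (by field_simp; ring)
    have h2 := aux_cc hconc (x := m) (y := m + (x + y)) (by simp) (by simp [h.le])
      (a := x / (x + y)) (b := y / (x + y)) (by positivity) (by positivity)
      (by field_simp)
    have e1 : y / (x + y) * m + x / (x + y) * (m + (x + y)) = m + x := by field_simp; ring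
    have e2 : x / (x + y) * m + y / (x + y) * (m + (x + y)) = m + y := by field_simp; ring
    rw [e1] at h1
    rw [e2] at h2
    have e3 : x / (x + y) = 1 - y / (x + y) := by field_simp; ring
    rw [e3] at h1 h2
    linarith

theorem aux_anderson0 {G : ℝ → ℝ} {m : ℝ} (hs : ∀ t, G (m + t) + G (m - t) = 1)
    (hconc : ConcaveOn ℝ (Ici m) G) (a r : ℝ) (ha : 0 ≤ a) (hr : 0 ≤ r) :
    G (m + (a + r)) - G (m + (a - r)) ≤ 2 * G (m + r) - 1 := by
  rcases le_total a r with h | h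
  · have h1 := aux_cc hconc (x := m + (a + r)) (y := m + (r - a))
      (by simp only [mem_Ici]; linarith) (by simp only [mem_Ici]; linarith)
      (a := 1 / 2) (b := 1 / 2) (by norm_num) (by norm_num) (by norm_num)
    rw [show (1:ℝ) / 2 * (m + (a + r)) + 1 / 2 * (m + (r - a)) = m + r by ring] at h1
    have := hs (r - a)
    rw [show m - (r - a) = m + (a - r) by ring] at this
    linarith
  · have h1 := aux_subadd hconc (x := a - r) (y := 2 * r) (by linarith) (by linarith)
    have h2 := aux_subadd hconc hr hr
    have h3 := hs 0
    simp only [add_zero, sub_zero] at h3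
    rw [show a - r + 2 * r = a + r by ring] at h1
    rw [show r + r = 2 * r by ring] at h2
    linarith

theorem aux_anderson {G : ℝ → ℝ} {m : ℝ} (hs : ∀ t, G (m + t) + G (m - t) = 1)
    (hconc : ConcaveOn ℝ (Ici m) G) (y r : ℝ) (hr : 0 ≤ r) :
    G (y + r) - G (y - r) ≤ G (m + r) - G (m - r) := by
  have h0 := hs r
  rcases le_total m y with h | h
  · have := aux_anderson0 hs hconc (y - m) r (by linarith) hr
    rw [show m + (y - m + r) = y + r by ring, show m + (y - m - r) = y - r by ring] at this
    linarith
  · have := aux_anderson0 hs hconc (m - y) r (by linarith) hr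
    have h1 := hs (m - y + r)
    have h2 := hs (m - y - r)
    rw [show m - (m - y + r) = y - r by ring] at h1
    rw [show m - (m - y - r) = y + r by ring] at h2
    linarith

theorem aux_strict {G : ℝ → ℝ} {m : ℝ} (ht : Filter.Tendsto G Filter.atTop (nhds 1))
    (hconc : ConcaveOn ℝ (Ici m) G) {a b : ℝ} (hma : m ≤ a) (hab : a < b) (h1 : G a < 1) :
    G a < G b := by
  by_contra! hcon
  have : ∀ c, b < c → G c ≤ G a := by
    intro c hc
    have := hconc.slope_anti_adjacent (x := a) (y := b) (z := c) hma
      (by simp only [mem_Ici]; linarith) hab hc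
    have h3 : (G b - G a) / (b - a) ≤ 0 :=
      div_nonpos_of_nonpos_of_nonneg (by linarith) (by linarith)
    have h4 : (G c - G b) / (c - b) ≤ 0 := this.trans h3
    rw [div_le_iff₀ (by linarith)] at h4
    linarith
  have h2 : (1:ℝ) ≤ G a := le_of_tendsto ht
    ((Filter.eventually_gt_atTop b).mono this)
  linarith

theorem aux_quant {G : ℝ → ℝ} (hm : Monotone G) (hc : Continuous G)
    (h1 : Filter.Tendsto G Filter.atTop (nhds 1)) (h0 : Filter.Tendsto G Filter.atBot (nhds 0))
    {u : ℝ} (hu : u ∈ Ioo (0:ℝ) 1) (t : ℝ) : sInf {t : ℝ | u ≤ G t} ≤ t ↔ u ≤ G t := by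
  have hbdd : BddBelow {t : ℝ | u ≤ G t} := by
    obtain ⟨b, hb⟩ := (h0.eventually (gt_mem_nhds hu.1)).exists
    refine ⟨b, fun t ht => ?_⟩
    by_contra! hlt
    have := hm hlt.le
    simp only [mem_ofPred_eq] at ht
    linarith
  have hne : {t : ℝ | u ≤ G t}.Nonempty := by
    obtain ⟨b, hb⟩ := (h1.eventually (lt_mem_nhds hu.2)).exists
    exact ⟨b, hb.le⟩
  have hcl : IsClosed {t : ℝ | u ≤ G t} := isClosed_le continuous_const hc
  constructor
  · intro h
    exact le_trans (hcl.csInf_mem hne hbdd) (hm h)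
  · intro h
    exact csInf_le hbdd h

theorem aux_exists {d : ℕ} (hd : 0 < d) (G : Fin d → ℝ → ℝ) (m : Fin d → ℝ)
    (hc : ∀ i, Continuous (G i)) (hm : ∀ i, Monotone (G i)) (hle : ∀ i t, G i t ≤ 1)
    (hhalf : ∀ i, G i (m i) = 1 / 2)
    (hst : ∀ i a b, m i ≤ a → a < b → G i a < 1 → G i a < G i b)
    (k : ℝ) (hk : 0 < k) :
    ∃ r : Fin d → ℝ, ∃ v : ℝ, (∀ i, 0 ≤ r i) ∧ (∀ i, G i (m i + r i) = v) ∧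
      ∑ i, r i ^ 2 ≤ k ∧ (v = 1 ∨ ∑ i, r i ^ 2 = k) := by
  have hne : (Finset.univ : Finset (Fin d)).Nonempty := ⟨⟨0, hd⟩, Finset.mem_univ _⟩
  let K : Set (Fin d → ℝ) := {r | (∀ i, 0 ≤ r i) ∧ ∑ i, r i ^ 2 ≤ k}
  have hKsub : K ⊆ Set.pi Set.univ (fun _ => Icc 0 (Real.sqrt k)) := by
    intro r hr i _
    refine ⟨hr.1 i, Real.le_sqrt_of_sq_le ?_⟩
    exact (Finset.single_le_sum (f := fun i => r i ^ 2) (fun i _ => sq_nonneg _)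
      (Finset.mem_univ i)).trans hr.2
  have hKcl : IsClosed K := by
    have : K = (⋂ i, {r : Fin d → ℝ | 0 ≤ r i}) ∩ {r | ∑ i, r i ^ 2 ≤ k} := by
      ext r; simp [K]
    rw [this]
    exact (isClosed_iInter fun i => isClosed_le (by fun_prop) (by fun_prop)).inter
      (isClosed_le (by fun_prop) (by fun_prop))
  have hKc : IsCompact K :=
    (isCompact_univ_pi fun _ => isCompact_Icc).of_isClosed_subset hKcl hKsub
  have hf : Continuous (Finset.univ.inf' hne (fun i (r : Fin d → ℝ) => G i (m i + r i))) :=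
    Continuous.finset_inf' hne (fun i _ => (hc i).comp (by fun_prop))
  obtain ⟨R, hR, hmax⟩ := hKc.exists_isMaxOn ⟨0, by simp [K, hk.le]⟩ hf.continuousOn
  set v := Finset.univ.inf' hne (fun i (r : Fin d → ℝ) => G i (m i + r i)) R with hv
  have hv1 : ∀ i, v ≤ G i (m i + R i) := by
    intro i
    rw [hv, Finset.inf'_apply]
    exact Finset.inf'_le (fun i => G i (m i + R i)) (Finset.mem_univ i)
  have hv2 : 1 / 2 ≤ v := by
    rw [hv, Finset.inf'_apply]
    refine Finset.le_inf' _ _ fun i _ => ?_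
    rw [← hhalf i]
    exact hm i (by linarith [hR.1 i])
  have hex : ∀ i, ∃ s ∈ Icc 0 (R i), G i (m i + s) = v := by
    intro i
    have := intermediate_value_Icc (hR.1 i) (f := fun s => G i (m i + s))
      ((hc i).comp (by fun_prop)).continuousOn
    exact this ⟨by simp [hhalf i]; linarith, hv1 i⟩
  choose r hr hrv using hex
  have hsum : ∑ i, r i ^ 2 ≤ k :=
    (Finset.sum_le_sum fun i _ => pow_le_pow_left₀ (hr i).1 (hr i).2 2).trans hR.2
  refine ⟨r, v, fun i => (hr i).1, hrv, hsum, ?_⟩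
  by_contra! hcon
  have hv3 : v < 1 := lt_of_le_of_ne (by rw [← hrv ⟨0, hd⟩]; exact hle _ _) hcon.1
  have hlt : ∑ i, r i ^ 2 < k := lt_of_le_of_ne hsum hcon.2
  have hcts : Continuous (fun e : ℝ => ∑ i, (r i + e) ^ 2) := by fun_prop
  have hev : ∀ᶠ e in nhds (0:ℝ), ∑ i, (r i + e) ^ 2 < k :=
    (hcts.tendsto 0).eventually (gt_mem_nhds (by simpa using hlt))
  obtain ⟨e, he, he0⟩ := ((hev.filter_mono nhdsWithin_le_nhds).and
    (self_mem_nhdsWithin (s := Ioi (0:ℝ)))).exists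
  replace he0 : 0 < e := he0
  have hmem : (fun i => r i + e) ∈ K := ⟨fun i => by linarith [(hr i).1], he.le⟩
  have h5 : Finset.univ.inf' hne (fun i (r : Fin d → ℝ) => G i (m i + r i))
      (fun i => r i + e) ≤ v := hmax hmem
  rw [Finset.inf'_apply, Finset.inf'_le_iff] at h5
  obtain ⟨i, _, hi⟩ := h5
  have := hst i (m i + r i) (m i + (r i + e)) (by linarith [(hr i).1]) (by linarith)
    (by rw [hrv]; exact hv3)
  rw [hrv] at this
  linarith

theorem aux_const (α : ℝ) (h0 : 0 < α) (h1 : α < 1) (s : ℝ) (hs : 0 ≤ s) :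
    ∫⁻ k in Ioi (0:ℝ), ENNReal.ofReal (min s k) * ENNReal.ofReal (k ^ (α - 2)) =
      ENNReal.ofReal (1 / α + 1 / (1 - α)) * ENNReal.ofReal (s ^ α) := by
  rcases hs.eq_or_lt with h | h
  · subst h
    rw [Real.zero_rpow h0.ne']
    simp only [ENNReal.ofReal_zero, mul_zero]
    rw [setLIntegral_congr_fun (g := fun _ => 0) measurableSet_Ioi]
    · simp
    · intro k hk
      simp [min_eq_left (le_of_lt (mem_Ioi.1 hk))]
  have hU : Ioi (0:ℝ) = Ioc 0 s ∪ Ioi s := (Ioc_union_Ioi_eq_Ioi h.le).symm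
  rw [hU, lintegral_union measurableSet_Ioi
    (by rw [Set.disjoint_left]; intro x hx hx2; exact absurd hx.2 (not_le.2 hx2))]
  have e1 : ∫⁻ k in Ioc 0 s, ENNReal.ofReal (min s k) * ENNReal.ofReal (k ^ (α - 2)) =
      ENNReal.ofReal (s ^ α / α) := by
    rw [setLIntegral_congr_fun (g := fun k => ENNReal.ofReal (k ^ (α - 1))) measurableSet_Ioc]
    · have hi : IntervalIntegrable (fun k : ℝ => k ^ (α - 1)) volume 0 s :=
        intervalIntegral.intervalIntegrable_rpow' (by linarith)
      rw [← ofReal_integral_eq_lintegral_ofReal]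
      · rw [← intervalIntegral.integral_of_le h.le, integral_rpow (Or.inl (by linarith))]
        simp [Real.zero_rpow h0.ne']
      · exact (intervalIntegrable_iff_integrableOn_Ioc_of_le h.le).1 hi
      · filter_upwards [ae_restrict_mem measurableSet_Ioc] with k hk
        exact Real.rpow_nonneg hk.1.le _
    · intro k hk
      simp only
      rw [min_eq_right hk.2, ← ENNReal.ofReal_mul hk.1.le]
      congr 1
      rw [show α - 1 = 1 + (α - 2) by ring, Real.rpow_add hk.1, Real.rpow_one]
  have e2 : ∫⁻ k in Ioi s, ENNReal.ofReal (min s k) * ENNReal.ofReal (k ^ (α - 2)) =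
      ENNReal.ofReal (s ^ α / (1 - α)) := by
    rw [setLIntegral_congr_fun (g := fun k => ENNReal.ofReal s * ENNReal.ofReal (k ^ (α - 2)))
      measurableSet_Ioi]
    · rw [lintegral_const_mul' _ _ ENNReal.ofReal_ne_top, ← ofReal_integral_eq_lintegral_ofReal]
      · rw [integral_Ioi_rpow_of_lt (by linarith) h, ← ENNReal.ofReal_mul h.le]
        congr 1
        have : s ^ α = s * s ^ (α - 1) := by
          rw [show α = 1 + (α - 1) by ring, Real.rpow_add h, Real.rpow_one]; ring_nf
        rw [this, show α - 2 + 1 = α - 1 by ring]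
        have h3 : α - 1 ≠ 0 := by linarith
        have h4 : 1 - α ≠ 0 := by linarith
        rw [show α - 1 = -(1 - α) by ring, neg_div_neg_eq]
        ring
      · exact integrableOn_Ioi_rpow_of_lt (by linarith) h
      · filter_upwards [ae_restrict_mem measurableSet_Ioi] with k hk
        exact Real.rpow_nonneg (h.trans hk).le _
    · intro k hk
      simp only
      rw [min_eq_left (le_of_lt hk)]
  rw [e1, e2]
  have : 0 < 1 - α := by linarith
  rw [← ENNReal.ofReal_add (by positivity) (by positivity), ← ENNReal.ofReal_mul (by positivity)]
  congr 1
  ring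

theorem aux_margCdf (d : ℕ) (F : Measure (Fin d → ℝ)) [IsProbabilityMeasure F] (i : Fin d) :
    margCdf d F i = ProbabilityTheory.cdf (Measure.map (fun x => x i) F) := by
  have : IsProbabilityMeasure (Measure.map (fun x : Fin d → ℝ => x i) F) :=
    Measure.isProbabilityMeasure_map (Measurable.aemeasurable (by fun_prop))
  funext t
  rw [ProbabilityTheory.cdf_eq_real]
  rfl

theorem aux_Icc (d : ℕ) (F : Measure (Fin d → ℝ)) [IsProbabilityMeasure F] (i : Fin d)
    (hc : Continuous (margCdf d F i)) (a b : ℝ) :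
    F {x | x i ∈ Icc a b} = ENNReal.ofReal (margCdf d F i b - margCdf d F i a) := by
  have hp : IsProbabilityMeasure (Measure.map (fun x : Fin d → ℝ => x i) F) :=
    Measure.isProbabilityMeasure_map (Measurable.aemeasurable (by fun_prop))
  have h1 := Measure.map_apply (μ := F) (f := fun x : Fin d → ℝ => x i) (by fun_prop)
    (measurableSet_Icc (a := a) (b := b))
  have h2 := (ProbabilityTheory.cdf (Measure.map (fun x : Fin d → ℝ => x i) F)).measure_Icc a b
  rw [ProbabilityTheory.measure_cdf, h1, ← aux_margCdf,
    hc.continuousAt.continuousWithinAt.leftLim_eq] at h2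
  exact h2

theorem aux_dist2 {d : ℕ} (β : ℝ) (x y : Fin d → ℝ) :
    dist2 x y ^ β = (∑ i, (x i - y i) ^ 2) ^ (β / 2) := by
  unfold dist2
  rw [Real.sqrt_eq_rpow, ← Real.rpow_mul (Finset.sum_nonneg fun i _ => sq_nonneg _)]
  congr 1
  ring

theorem aux_mix {d : ℕ} (β : ℝ) (hβ0 : 0 < β) (hβ2 : β < 2) (P : Measure (Fin d → ℝ))
    [SFinite P] (y : Fin d → ℝ) :
    ENNReal.ofReal (1 / (β / 2) + 1 / (1 - β / 2)) *
      ∫⁻ x, ENNReal.ofReal (dist2 x y ^ β) ∂P =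
    ∫⁻ k in Ioi (0:ℝ), (∫⁻ x, ENNReal.ofReal (min (∑ i, (x i - y i) ^ 2) k) ∂P) *
      ENNReal.ofReal (k ^ (β / 2 - 2)) := by
  rw [← lintegral_const_mul' _ _ ENNReal.ofReal_ne_top]
  have h1 : ∀ x : Fin d → ℝ, ENNReal.ofReal (1 / (β / 2) + 1 / (1 - β / 2)) *
      ENNReal.ofReal (dist2 x y ^ β) =
      ∫⁻ k in Ioi (0:ℝ), ENNReal.ofReal (min (∑ i, (x i - y i) ^ 2) k) *
        ENNReal.ofReal (k ^ (β / 2 - 2)) := by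
    intro x
    rw [aux_const (β / 2) (by linarith) (by linarith) _ (Finset.sum_nonneg fun i _ => sq_nonneg _),
      aux_dist2]
  simp_rw [h1]
  rw [lintegral_lintegral_swap]
  · refine lintegral_congr fun k => ?_
    rw [lintegral_mul_const' _ _ ENNReal.ofReal_ne_top]
  · apply Measurable.aemeasurable
    unfold Function.uncurry
    fun_prop

theorem aux_quant_iff (d : ℕ) (F : Measure (Fin d → ℝ)) [IsProbabilityMeasure F] (i : Fin d)
    (hc : Continuous (margCdf d F i)) {u : ℝ} (hu : u ∈ Ioo (0:ℝ) 1) (t : ℝ) :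
    margQuantile d F i u ≤ t ↔ u ≤ margCdf d F i t := by
  unfold margQuantile
  refine aux_quant ?_ hc ?_ ?_ hu t
  · rw [aux_margCdf]; exact ProbabilityTheory.monotone_cdf _
  · rw [aux_margCdf]; exact ProbabilityTheory.tendsto_cdf_atTop _
  · rw [aux_margCdf]; exact ProbabilityTheory.tendsto_cdf_atBot _

theorem aux_quant_aem (d : ℕ) (F : Measure (Fin d → ℝ)) [IsProbabilityMeasure F]
    (hc : ∀ i, Continuous (margCdf d F i)) :
    AEMeasurable (fun u : ℝ => fun i : Fin d => margQuantile d F i u)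
      (volume.restrict (Set.Ioo 0 1)) := by
  refine aemeasurable_pi_lambda _ fun i => ?_
  refine aemeasurable_restrict_of_monotoneOn measurableSet_Ioo ?_
  intro u hu v hv huv
  rw [aux_quant_iff d F i (hc i) hu]
  exact huv.trans ((aux_quant_iff d F i (hc i) hv _).1 le_rfl)

theorem aux_como_prob (d : ℕ) (F : Measure (Fin d → ℝ)) [IsProbabilityMeasure F]
    (hc : ∀ i, Continuous (margCdf d F i)) : IsProbabilityMeasure (comonotone d F) := by
  have : IsProbabilityMeasure (volume.restrict (Set.Ioo (0:ℝ) 1)) := ⟨by simp⟩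
  exact Measure.isProbabilityMeasure_map (aux_quant_aem d F hc)

theorem aux_tail (d : ℕ) (F : Measure (Fin d → ℝ)) [IsProbabilityMeasure F]
    (hc : ∀ i, Continuous (margCdf d F i)) (i : Fin d) (m y : ℝ)
    (hs : ∀ t, margCdf d F i (m + t) + margCdf d F i (m - t) = 1)
    (hconc : ConcaveOn ℝ (Set.Ici m) (margCdf d F i)) (t : ℝ) (ht : 0 < t) :
    comonotone d F {x | t < (x i - m) ^ 2} ≤ F {x | t < (x i - y) ^ 2} := by
  have := aux_como_prob d F hc
  have key : ∀ c : ℝ, {x : Fin d → ℝ | t < (x i - c) ^ 2} =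
      {x | x i ∈ Icc (c - √t) (c + √t)}ᶜ := by
    intro c
    ext x
    simp only [mem_ofPred_eq, mem_compl_iff, mem_Icc]
    rw [← not_le, not_iff_not, Real.sq_le ht.le]
    constructor <;> rintro ⟨h1, h2⟩ <;> constructor <;> linarith
  have hms : ∀ c : ℝ, MeasurableSet {x : Fin d → ℝ | x i ∈ Icc (c - √t) (c + √t)} :=
    fun c => measurableSet_Icc.preimage (measurable_pi_apply i)
  rw [key, key, prob_compl_eq_one_sub (hms _), prob_compl_eq_one_sub (hms _)]
  refine tsub_le_tsub_left ?_ _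
  rw [aux_Icc d F i (hc i)]
  refine (ENNReal.ofReal_le_ofReal
    (aux_anderson hs hconc y (√t) (Real.sqrt_nonneg t))).trans ?_
  unfold comonotone
  rw [Measure.map_apply_of_aemeasurable (aux_quant_aem d F hc) (hms _),
    Measure.restrict_apply' measurableSet_Ioo, ← Real.volume_Ioo]
  refine measure_mono ?_
  have hrange : ∀ s, 0 ≤ margCdf d F i s ∧ margCdf d F i s ≤ 1 := by
    intro s
    rw [aux_margCdf]
    exact ⟨ProbabilityTheory.cdf_nonneg _ _, ProbabilityTheory.cdf_le_one _ _⟩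
  intro u hu
  have hu' : u ∈ Ioo (0:ℝ) 1 :=
    ⟨lt_of_le_of_lt (hrange _).1 hu.1, lt_of_lt_of_le hu.2 (hrange _).2⟩
  refine ⟨?_, hu'⟩
  have h1 := (aux_quant_iff d F i (hc i) hu' (m + √t)).2 hu.2.le
  have h2 := mt (aux_quant_iff d F i (hc i) hu' (m - √t)).1 (not_le.2 hu.1)
  exact ⟨(not_le.1 h2).le, h1⟩

theorem aux_marg (d : ℕ) (F : Measure (Fin d → ℝ)) [IsProbabilityMeasure F]
    (hc : ∀ i, Continuous (margCdf d F i)) (i : Fin d) (m y : ℝ)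
    (hs : ∀ t, margCdf d F i (m + t) + margCdf d F i (m - t) = 1)
    (hconc : ConcaveOn ℝ (Set.Ici m) (margCdf d F i)) (K : ℝ) (hK : 0 ≤ K) :
    ∫⁻ x, ENNReal.ofReal (min ((x i - m) ^ 2) K) ∂(comonotone d F) ≤
      ∫⁻ x, ENNReal.ofReal (min ((x i - y) ^ 2) K) ∂F := by
  rw [lintegral_eq_lintegral_meas_lt _ (Filter.Eventually.of_forall fun x =>
      le_min (sq_nonneg _) hK) (Measurable.aemeasurable (by fun_prop)),
    lintegral_eq_lintegral_meas_lt _ (Filter.Eventually.of_forall fun x =>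
      le_min (sq_nonneg _) hK) (Measurable.aemeasurable (by fun_prop))]
  refine setLIntegral_mono' measurableSet_Ioi fun t ht => ?_
  by_cases h : t < K
  · simp only [lt_min_iff, h, and_true]
    exact aux_tail d F hc i m y hs hconc t ht
  · simp [h]

theorem aux_k (d : ℕ) (hd : 0 < d) (F : Measure (Fin d → ℝ)) [IsProbabilityMeasure F]
    (μvec : Fin d → ℝ)
    (hc : ∀ i, Continuous (margCdf d F i))
    (hs : ∀ i t, margCdf d F i (μvec i + t) + margCdf d F i (μvec i - t) = 1)
    (hconc : ∀ i, ConcaveOn ℝ (Set.Ici (μvec i)) (margCdf d F i)) (y : Fin d → ℝ)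
    (k : ℝ) (hk : 0 < k) :
    ∫⁻ x, ENNReal.ofReal (min (∑ i, (x i - μvec i) ^ 2) k) ∂(comonotone d F) ≤
      ∫⁻ x, ENNReal.ofReal (min (∑ i, (x i - y i) ^ 2) k) ∂F := by
  obtain ⟨r, v, hr0, hrv, hrk, hor⟩ := aux_exists hd (margCdf d F) μvec hc
    (fun i => by rw [aux_margCdf]; exact ProbabilityTheory.monotone_cdf _)
    (fun i t => by rw [aux_margCdf]; exact ProbabilityTheory.cdf_le_one _ _)
    (fun i => by have := hs i 0; simp only [add_zero, sub_zero] at this; linarith)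
    (fun i a b hma hab h1 => aux_strict
      (by rw [aux_margCdf]; exact ProbabilityTheory.tendsto_cdf_atTop _) (hconc i) hma hab h1)
    k hk
  have hsumm : ∀ z : Fin d → ℝ, ∀ P : Measure (Fin d → ℝ),
      ∫⁻ x, ENNReal.ofReal (∑ i, min ((x i - z i) ^ 2) (r i ^ 2)) ∂P =
      ∑ i, ∫⁻ x, ENNReal.ofReal (min ((x i - z i) ^ 2) (r i ^ 2)) ∂P := by
    intro z P
    rw [← lintegral_finsetSum _ (fun i _ => by fun_prop)]
    refine lintegral_congr fun x => ?_
    rw [ENNReal.ofReal_sum_of_nonneg fun i _ => le_min (sq_nonneg _) (sq_nonneg _)]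
  calc ∫⁻ x, ENNReal.ofReal (min (∑ i, (x i - μvec i) ^ 2) k) ∂(comonotone d F)
      ≤ ∫⁻ x, ENNReal.ofReal (∑ i, min ((x i - μvec i) ^ 2) (r i ^ 2)) ∂(comonotone d F) := by
        unfold comonotone
        rw [lintegral_map' (Measurable.aemeasurable (by fun_prop)) (aux_quant_aem d F hc),
          lintegral_map' (Measurable.aemeasurable (by fun_prop)) (aux_quant_aem d F hc)]
        refine setLIntegral_mono' measurableSet_Ioo fun u hu => ENNReal.ofReal_le_ofReal ?_
        have hq := fun i t => aux_quant_iff d F i (hc i) hu t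
        have hlow : ∀ i, margCdf d F i (μvec i - r i) = 1 - v := fun i => by
          have := hs i (r i); rw [hrv] at this; linarith
        by_cases hin : 1 - v < u ∧ u ≤ v
        · refine (min_le_left _ _).trans (Finset.sum_le_sum fun i _ => le_min le_rfl ?_)
          have h1 := (hq i (μvec i + r i)).2 (by rw [hrv]; exact hin.2)
          have h2 := mt (hq i (μvec i - r i)).1 (by rw [hlow]; exact not_le.2 hin.1)
          rw [not_le] at h2
          exact sq_le_sq' (by linarith) (by linarith)
        · have hk' : ∑ i, r i ^ 2 = k := by
            rcases hor with h | h
            · exfalso; apply hin; subst h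
              exact ⟨by linarith [hu.1], hu.2.le⟩
            · exact h
          refine (min_le_right _ _).trans ?_
          rw [← hk']
          refine Finset.sum_le_sum fun i _ => le_min ?_ le_rfl
          by_cases hv : u ≤ v
          · have h3 : u ≤ 1 - v := by
              by_contra! h4; exact hin ⟨h4, hv⟩
            have h1 := (hq i (μvec i - r i)).2 (by rw [hlow]; exact h3)
            have := hr0 i
            nlinarith
          · have h2 := mt (hq i (μvec i + r i)).1 (by rw [hrv]; exact hv)
            rw [not_le] at h2
            have := hr0 i
            nlinarith
    _ = ∑ i, ∫⁻ x, ENNReal.ofReal (min ((x i - μvec i) ^ 2) (r i ^ 2)) ∂(comonotone d F) :=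
        hsumm _ _
    _ ≤ ∑ i, ∫⁻ x, ENNReal.ofReal (min ((x i - y i) ^ 2) (r i ^ 2)) ∂F :=
        Finset.sum_le_sum fun i _ =>
          aux_marg d F hc i (μvec i) (y i) (hs i) (hconc i) _ (sq_nonneg _)
    _ = ∫⁻ x, ENNReal.ofReal (∑ i, min ((x i - y i) ^ 2) (r i ^ 2)) ∂F := (hsumm _ _).symm
    _ ≤ _ := by
        refine lintegral_mono fun x => ENNReal.ofReal_le_ofReal (le_min ?_ ?_)
        · exact Finset.sum_le_sum fun i _ => min_le_left _ _
        · exact (Finset.sum_le_sum fun i _ => min_le_right _ _).trans hrk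

theorem aux_meas {d : ℕ} (β : ℝ) (y : Fin d → ℝ) : Measurable fun x : Fin d → ℝ => dist2 x y ^ β := by
  unfold dist2
  fun_prop

theorem aux_int {d : ℕ} (β : ℝ) (hβ0 : 0 < β) (hβ2 : β < 2) (F : Measure (Fin d → ℝ))
    [IsProbabilityMeasure F] (hmom : Integrable (fun x => euclNorm x ^ β) F) (y : Fin d → ℝ) :
    Integrable (fun x => dist2 x y ^ β) F := by
  have he : ∀ x : Fin d → ℝ, euclNorm x ^ β = (∑ i, (x i) ^ 2) ^ (β / 2) := by
    intro x
    have := aux_dist2 β x 0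
    simpa [dist2, euclNorm] using this
  have hb : Integrable (fun x => (2:ℝ) ^ (β / 2) * euclNorm x ^ β
      + (2:ℝ) ^ (β / 2) * euclNorm y ^ β) F := (hmom.const_mul _).add (integrable_const _)
  refine hb.mono' (aux_meas β y).aestronglyMeasurable (Filter.Eventually.of_forall fun x => ?_)
  have hx0 : 0 ≤ ∑ i, (x i) ^ 2 := Finset.sum_nonneg fun i _ => sq_nonneg _
  have hy0 : 0 ≤ ∑ i, (y i) ^ 2 := Finset.sum_nonneg fun i _ => sq_nonneg _
  have hxy0 : 0 ≤ ∑ i, (x i - y i) ^ 2 := Finset.sum_nonneg fun i _ => sq_nonneg _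
  rw [aux_dist2, he, he, Real.norm_of_nonneg (Real.rpow_nonneg hxy0 _),
    ← Real.mul_rpow (by norm_num) hx0, ← Real.mul_rpow (by norm_num) hy0]
  refine le_trans ?_ (Real.rpow_add_le_add_rpow (by positivity) (by positivity) (by linarith)
    (by linarith))
  refine Real.rpow_le_rpow hxy0 ?_ (by linarith)
  rw [Finset.mul_sum, Finset.mul_sum, ← Finset.sum_add_distrib]
  exact Finset.sum_le_sum fun i _ => by nlinarith [sq_nonneg (x i + y i)]

/-- if all marginals of `F` are continuous, unimodal and symmetric with
respect to `μ₁,…,μ_d`, then for every `y ∈ ℝ^d`, `S_β(F,y) ≥ S_β(F⁺,μ)`. -/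
theorem stmt14 (d : ℕ) (β : ℝ) (hβ0 : 0 < β) (hβ2 : β < 2)
    (F : Measure (Fin d → ℝ)) [IsProbabilityMeasure F]
    (hmom : Integrable (fun x => euclNorm x ^ β) F)
    (μvec : Fin d → ℝ)
    (hcont : ∀ i, Continuous (margCdf d F i))
    (hsym : ∀ i, ∀ t > 0, margCdf d F i (μvec i + t) + margCdf d F i (μvec i - t) = 1)
    (hconv : ∀ i, ConvexOn ℝ (Set.Iic (μvec i)) (margCdf d F i))
    (hconc : ∀ i, ConcaveOn ℝ (Set.Ici (μvec i)) (margCdf d F i)) :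
    ∀ y : Fin d → ℝ, SbY d β F y ≥ SbY d β (comonotone d F) μvec := by
  intro y
  have hs : ∀ i t, margCdf d F i (μvec i + t) + margCdf d F i (μvec i - t) = 1 :=
    fun i => aux_sym0 (hcont i) (hsym i)
  have := aux_como_prob d F hcont
  have hnn : ∀ x z : Fin d → ℝ, 0 ≤ dist2 x z ^ β :=
    fun x z => Real.rpow_nonneg (Real.sqrt_nonneg _) _
  rcases Nat.eq_zero_or_pos d with hd | hd
  · subst hd
    simp [SbY, dist2, Real.zero_rpow hβ0.ne']
  unfold SbY
  rw [ge_iff_le, integral_eq_lintegral_of_nonneg_ae (Filter.Eventually.of_forall fun x => hnn x _)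
      (aux_meas β _).aestronglyMeasurable,
    integral_eq_lintegral_of_nonneg_ae (Filter.Eventually.of_forall fun x => hnn x _)
      (aux_meas β _).aestronglyMeasurable]
  refine ENNReal.toReal_mono ?_ ?_
  · have h := (aux_int β hβ0 hβ2 F hmom y).lintegral_lt_top
    exact h.ne
  · have hC : 0 < 1 / (β / 2) + 1 / (1 - β / 2) := by
      have : 0 < 1 - β / 2 := by linarith
      positivity
    have hC0 : ENNReal.ofReal (1 / (β / 2) + 1 / (1 - β / 2)) ≠ 0 := by
      simpa using hC
    rw [← ENNReal.mul_le_mul_iff_right hC0 ENNReal.ofReal_ne_top,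
      aux_mix β hβ0 hβ2, aux_mix β hβ0 hβ2]
    refine setLIntegral_mono' measurableSet_Ioi fun k hk => ?_
    exact mul_le_mul_left (aux_k d hd F μvec hcont hs hconc y k hk) _
end

section
/- Let β ∈ [1,2). Then (i) for every probability measure F on ℝ^d with finite β-th moment, the map y ↦ ES_β(F,y) is a convex function on ℝ^d; and (ii) for every y ∈ ℝ^d, the map F ↦ ES_β(F,y) is convex under mixtures: for probability measures F, G with finite β-th moments and α ∈ (0,1), ES_β(αF+(1−α)G, y) ≤ α·ES_β(F,y) + (1−α)·ES_β(G,y). -/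
open MeasureTheory Set
open scoped ENNReal

/-- `S_β(F,F) = ∫∫ ‖x-x'‖₂^β F(dx) F(dx')`. -/
noncomputable def Sb (d : ℕ) (β : ℝ) (F G : Measure (Fin d → ℝ)) : ℝ :=
  ∫ x, ∫ y, dist2 x y ^ β ∂G ∂F

/-- The generalized energy score `ES_β(F,y) = S_β(F,y) - (1/2)·S_β(F,F)`. -/
noncomputable def ES (d : ℕ) (β : ℝ) (F : Measure (Fin d → ℝ)) (y : Fin d → ℝ) : ℝ :=
  SbY d β F y - (1 / 2) * Sb d β F F

lemma dist2_eq_norm {d : ℕ} (x y : Fin d → ℝ) :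
    dist2 x y = ‖WithLp.toLp 2 x - WithLp.toLp 2 y‖ := by
  rw [EuclideanSpace.norm_eq]
  simp [dist2]

lemma euclNorm_eq_norm {d : ℕ} (x : Fin d → ℝ) :
    euclNorm x = ‖WithLp.toLp 2 x‖ := by
  rw [EuclideanSpace.norm_eq]
  simp [euclNorm]

lemma dist2_nonneg' {d : ℕ} (x y : Fin d → ℝ) : 0 ≤ dist2 x y := Real.sqrt_nonneg _

lemma dist2_sq {d : ℕ} (x y : Fin d → ℝ) : dist2 x y ^ 2 = ∑ i, (x i - y i) ^ 2 :=
  Real.sq_sqrt (Finset.sum_nonneg fun _ _ => sq_nonneg _)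

lemma dist2_cont {d : ℕ} : Continuous (fun p : (Fin d → ℝ) × (Fin d → ℝ) => dist2 p.1 p.2) := by
  unfold dist2; fun_prop

lemma dist2_meas {d : ℕ} {A : Type*} [MeasurableSpace A] {f g : A → Fin d → ℝ}
    (hf : Measurable f) (hg : Measurable g) : Measurable fun a => dist2 (f a) (g a) := by
  unfold dist2; fun_prop

lemma dist2_comm' {d : ℕ} (x y : Fin d → ℝ) : dist2 x y = dist2 y x := by
  rw [dist2_eq_norm, dist2_eq_norm, norm_sub_rev]

lemma dist2_rpow_le {d : ℕ} {β : ℝ} (hβ : 1 ≤ β) (x y : Fin d → ℝ) :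
    dist2 x y ^ β ≤ 2 ^ (β - 1) * (euclNorm x ^ β + euclNorm y ^ β) := by
  have h1 : dist2 x y ≤ euclNorm x + euclNorm y := by
    rw [dist2_eq_norm, euclNorm_eq_norm, euclNorm_eq_norm]; exact norm_sub_le _ _
  refine (Real.rpow_le_rpow (dist2_nonneg' x y) h1 (by linarith)).trans ?_
  have h := NNReal.rpow_add_le_mul_rpow_add_rpow ⟨euclNorm x, Real.sqrt_nonneg _⟩
    ⟨euclNorm y, Real.sqrt_nonneg _⟩ hβ
  exact_mod_cast h

lemma dist2_rpow_cont {d : ℕ} {β : ℝ} (hβ : 1 ≤ β) :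
    Continuous (fun p : (Fin d → ℝ) × (Fin d → ℝ) => dist2 p.1 p.2 ^ β) :=
  dist2_cont.rpow_const fun _ => Or.inr (by linarith)

lemma integrable_left {d : ℕ} {β : ℝ} (hβ : 1 ≤ β) (F : Measure (Fin d → ℝ))
    [IsProbabilityMeasure F] (hF : Integrable (fun x => euclNorm x ^ β) F) (y : Fin d → ℝ) :
    Integrable (fun x => dist2 x y ^ β) F := by
  refine Integrable.mono' ((hF.add (integrable_const (euclNorm y ^ β))).const_mul (2 ^ (β - 1)))
    ?_ (ae_of_all _ fun x => ?_)
  · exact ((dist2_rpow_cont hβ).comp (Continuous.prodMk_left y)).aestronglyMeasurable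
  · rw [Real.norm_of_nonneg (Real.rpow_nonneg (dist2_nonneg' _ _) _)]
    exact dist2_rpow_le hβ x y

lemma integrable_pair {d : ℕ} {β : ℝ} (hβ : 1 ≤ β) (F G : Measure (Fin d → ℝ))
    [IsProbabilityMeasure F] [IsProbabilityMeasure G]
    (hF : Integrable (fun x => euclNorm x ^ β) F) (hG : Integrable (fun x => euclNorm x ^ β) G) :
    Integrable (fun p : (Fin d → ℝ) × (Fin d → ℝ) => dist2 p.1 p.2 ^ β) (F.prod G) := by
  refine Integrable.mono' (((hF.comp_fst G).add (hG.comp_snd F)).const_mul (2 ^ (β - 1)))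
    ?_ (ae_of_all _ fun x => ?_)
  · exact (dist2_rpow_cont hβ).aestronglyMeasurable
  · rw [Real.norm_of_nonneg (Real.rpow_nonneg (dist2_nonneg' _ _) _)]
    exact dist2_rpow_le hβ x.1 x.2

lemma convex_part {d : ℕ} {β : ℝ} (hβ : 1 ≤ β) (F : Measure (Fin d → ℝ))
    [IsProbabilityMeasure F] (hF : Integrable (fun x => euclNorm x ^ β) F) :
    ConvexOn ℝ Set.univ (fun y => ES d β F y) := by
  refine ⟨convex_univ, fun y _ z _ a b ha hb hab => ?_⟩
  have key : SbY d β F (a • y + b • z) ≤ a * SbY d β F y + b * SbY d β F z := by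
    unfold SbY
    rw [← integral_const_mul, ← integral_const_mul, ← integral_add
      ((integrable_left hβ F hF y).const_mul a) ((integrable_left hβ F hF z).const_mul b)]
    refine integral_mono (integrable_left hβ F hF _)
      (((integrable_left hβ F hF y).const_mul a).add ((integrable_left hβ F hF z).const_mul b))
      fun x => ?_
    have h1 : dist2 x (a • y + b • z) ≤ a * dist2 x y + b * dist2 x z := by
      simp only [dist2_eq_norm]
      have : WithLp.toLp 2 x - WithLp.toLp 2 (a • y + b • z) =
          a • (WithLp.toLp 2 x - WithLp.toLp 2 y) + b • (WithLp.toLp 2 x - WithLp.toLp 2 z) := by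
        have : WithLp.toLp 2 x = (a + b) • WithLp.toLp 2 x := by rw [hab, one_smul]
        rw [WithLp.toLp_add, WithLp.toLp_smul, WithLp.toLp_smul]
        nth_rewrite 1 [this]
        module
      rw [this]
      refine (norm_add_le _ _).trans ?_
      rw [norm_smul, norm_smul, Real.norm_of_nonneg ha, Real.norm_of_nonneg hb]
    refine (Real.rpow_le_rpow (dist2_nonneg' _ _) h1 (by linarith)).trans ?_
    exact (convexOn_rpow hβ).2 (dist2_nonneg' x y) (dist2_nonneg' x z) ha hb hab
  simp only [ES, smul_eq_mul]
  have : (1 / 2) * Sb d β F F = a * ((1 / 2) * Sb d β F F) + b * ((1 / 2) * Sb d β F F) := by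
    rw [← add_mul, hab, one_mul]
  nlinarith

/-- The Gaussian kernel. -/
noncomputable def gk {d : ℕ} (t : ℝ) (x y : Fin d → ℝ) : ℝ := Real.exp (-(t * dist2 x y ^ 2))

lemma gk_meas0 {d : ℕ} {A : Type*} [MeasurableSpace A] {t : A → ℝ} {f g : A → Fin d → ℝ}
    (ht : Measurable t) (hf : Measurable f) (hg : Measurable g) :
    Measurable fun a => gk (t a) (f a) (g a) := by
  have := dist2_meas hf hg
  unfold gk; fun_prop

lemma gk_meas1 {d : ℕ} {A : Type*} [MeasurableSpace A] (t : ℝ) {f g : A → Fin d → ℝ}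
    (hf : Measurable f) (hg : Measurable g) :
    Measurable fun a => ENNReal.ofReal (gk t (f a) (g a)) :=
  (gk_meas0 measurable_const hf hg).ennreal_ofReal

lemma gk_meas {d : ℕ} (t : ℝ) :
    Measurable (fun p : (Fin d → ℝ) × (Fin d → ℝ) => ENNReal.ofReal (gk t p.1 p.2)) :=
  gk_meas1 t measurable_fst measurable_snd

lemma gk_le_one {d : ℕ} {t : ℝ} (ht : 0 < t) (x y : Fin d → ℝ) : gk t x y ≤ 1 := by
  unfold gk
  rw [Real.exp_le_one_iff]
  have := mul_nonneg ht.le (sq_nonneg (dist2 x y))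
  linarith

lemma gk_mul {d : ℕ} (t : ℝ) (x y u : Fin d → ℝ) :
    gk (2 * t) x u * gk (2 * t) y u = gk t x y * gk (4 * t) (u - (1 / 2 : ℝ) • (x + y)) 0 := by
  unfold gk
  rw [← Real.exp_add, ← Real.exp_add]
  congr 1
  simp only [dist2_sq, Finset.mul_sum, ← Finset.sum_neg_distrib, ← Finset.sum_add_distrib]
  refine Finset.sum_congr rfl fun i _ => ?_
  simp
  ring

lemma gauss_const {d : ℕ} {t : ℝ} (ht : 0 < t) :
    (∫⁻ u : Fin d → ℝ, ENNReal.ofReal (gk t u 0)) ≠ 0 ∧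
    (∫⁻ u : Fin d → ℝ, ENNReal.ofReal (gk t u 0)) ≠ ∞ := by
  have hc : Measurable (fun u : Fin d → ℝ => ENNReal.ofReal (gk t u 0)) :=
    gk_meas1 t measurable_id measurable_const
  constructor
  · rw [← pos_iff_ne_zero, lintegral_pos_iff_support hc]
    have : Function.support (fun u : Fin d → ℝ => ENNReal.ofReal (gk t u 0)) = Set.univ := by
      ext u
      simp [gk, Real.exp_pos]
    rw [this]
    exact isOpen_univ.measure_pos _ Set.univ_nonempty
  · have h : Integrable (fun u : Fin d → ℝ => gk t u 0) := by
      have h1 : Integrable (fun u : Fin d → ℝ => ∏ i, Real.exp (-t * (u i) ^ 2)) :=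
        Integrable.fintype_prod (f := fun _ s => Real.exp (-t * s ^ 2))
          fun _ => integrable_exp_neg_mul_sq ht
      convert h1 using 2 with u
      unfold gk
      rw [← Real.exp_sum, dist2_sq, Finset.mul_sum, ← Finset.sum_neg_distrib]
      simp
    exact h.lintegral_lt_top.ne

/-- The Gaussian double integral. -/
noncomputable def GM {d : ℕ} (t : ℝ) (F G : Measure (Fin d → ℝ)) : ℝ≥0∞ :=
  ∫⁻ x, ∫⁻ y, ENNReal.ofReal (gk t x y) ∂G ∂F

lemma GM_eq {d : ℕ} (t : ℝ) (F G : Measure (Fin d → ℝ))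
    [IsProbabilityMeasure F] [IsProbabilityMeasure G] :
    GM t F G * (∫⁻ u : Fin d → ℝ, ENNReal.ofReal (gk (4 * t) u 0)) =
      ∫⁻ u, (∫⁻ x, ENNReal.ofReal (gk (2 * t) x u) ∂F) *
        (∫⁻ y, ENNReal.ofReal (gk (2 * t) y u) ∂G) := by
  have hpt : ∀ x y : Fin d → ℝ, (∫⁻ u, ENNReal.ofReal (gk (2 * t) x u) *
      ENNReal.ofReal (gk (2 * t) y u)) = ENNReal.ofReal (gk t x y) *
      ∫⁻ u : Fin d → ℝ, ENNReal.ofReal (gk (4 * t) u 0) := by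
    intro x y
    have h0 : ∀ t (x y : Fin d → ℝ), 0 ≤ gk t x y := fun t x y => (Real.exp_pos _).le
    simp_rw [← ENNReal.ofReal_mul (h0 _ _ _), gk_mul, ENNReal.ofReal_mul (h0 _ _ _)]
    rw [lintegral_const_mul]
    · congr 1
      exact lintegral_sub_right_eq_self (fun u : Fin d → ℝ => ENNReal.ofReal (gk (4 * t) u 0)) _
    · exact gk_meas1 (4 * t) (measurable_id.sub_const _) measurable_const
  have hm := gk_meas (d := d) (2 * t)
  have hm1 : ∀ u : Fin d → ℝ, Measurable fun x => ENNReal.ofReal (gk (2 * t) x u) := fun u =>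
    gk_meas1 _ measurable_id measurable_const
  have hm3 : Measurable (fun p : (Fin d → ℝ) × (Fin d → ℝ) => ENNReal.ofReal (gk t p.1 p.2)) :=
    gk_meas t
  symm
  calc _ = ∫⁻ u, (∫⁻ x, (∫⁻ y, ENNReal.ofReal (gk (2 * t) x u) *
        ENNReal.ofReal (gk (2 * t) y u) ∂G) ∂F) := by
        refine lintegral_congr fun u => ?_
        rw [← lintegral_mul_const _ (hm1 u)]
        refine lintegral_congr fun x => ?_
        rw [← lintegral_const_mul _ (hm1 u)]
    _ = ∫⁻ x, (∫⁻ u, (∫⁻ y, ENNReal.ofReal (gk (2 * t) x u) *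
        ENNReal.ofReal (gk (2 * t) y u) ∂G)) ∂F := by
        refine lintegral_lintegral_swap (Measurable.aemeasurable ?_)
        refine Measurable.lintegral_prod_right'
          (f := fun q : ((Fin d → ℝ) × (Fin d → ℝ)) × (Fin d → ℝ) =>
            ENNReal.ofReal (gk (2 * t) q.1.2 q.1.1) * ENNReal.ofReal (gk (2 * t) q.2 q.1.1)) ?_
        exact (gk_meas1 _ (by fun_prop) (by fun_prop)).mul
          (gk_meas1 _ (by fun_prop) (by fun_prop))
    _ = ∫⁻ x, (∫⁻ y, (∫⁻ u, ENNReal.ofReal (gk (2 * t) x u) *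
        ENNReal.ofReal (gk (2 * t) y u)) ∂G) ∂F := by
        refine lintegral_congr fun x => ?_
        refine lintegral_lintegral_swap (Measurable.aemeasurable ?_)
        exact (gk_meas1 _ (by fun_prop) (by fun_prop)).mul
          (gk_meas1 _ (by fun_prop) (by fun_prop))
    _ = _ := by
        simp_rw [hpt]
        unfold GM
        rw [← lintegral_mul_const _ (Measurable.lintegral_prod_right' hm3)]
        refine lintegral_congr fun x => ?_
        rw [← lintegral_mul_const _ (show Measurable fun y => ENNReal.ofReal (gk t x y) from
          gk_meas1 _ measurable_const measurable_id)]

lemma ennreal_two_mul (a b : ℝ≥0∞) : 2 * (a * b) ≤ a * a + b * b := by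
  rcases eq_or_ne a ∞ with rfl | ha
  · simp
  rcases eq_or_ne b ∞ with rfl | hb
  · simp
  lift a to NNReal using ha
  lift b to NNReal using hb
  norm_cast
  have := two_mul_le_add_sq a b
  nlinarith

lemma GM_psd {d : ℕ} {t : ℝ} (ht : 0 < t) (F G : Measure (Fin d → ℝ))
    [IsProbabilityMeasure F] [IsProbabilityMeasure G] :
    2 * GM t F G ≤ GM t F F + GM t G G := by
  obtain ⟨h0, h1⟩ := gauss_const (d := d) (t := 4 * t) (by linarith)
  rw [← ENNReal.mul_le_mul_iff_left h0 h1, add_mul, mul_assoc, GM_eq, GM_eq, GM_eq]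
  have hm : ∀ F : Measure (Fin d → ℝ), IsProbabilityMeasure F →
      Measurable fun u => ∫⁻ x, ENNReal.ofReal (gk (2 * t) x u) ∂F := fun F _ =>
    Measurable.lintegral_prod_left' (gk_meas (2 * t))
  have hF := hm F inferInstance
  have hG := hm G inferInstance
  have hFG : Measurable fun u => (∫⁻ x, ENNReal.ofReal (gk (2 * t) x u) ∂F) *
    (∫⁻ x, ENNReal.ofReal (gk (2 * t) x u) ∂G) := hF.mul hG
  have hFF : Measurable fun u => (∫⁻ x, ENNReal.ofReal (gk (2 * t) x u) ∂F) *
    (∫⁻ x, ENNReal.ofReal (gk (2 * t) x u) ∂F) := hF.mul hF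
  rw [← lintegral_const_mul _ hFG, ← lintegral_add_left hFF]
  exact lintegral_mono fun u => ennreal_two_mul _ _

lemma GM_le_one {d : ℕ} {t : ℝ} (ht : 0 < t) (F G : Measure (Fin d → ℝ))
    [IsProbabilityMeasure F] [IsProbabilityMeasure G] : GM t F G ≤ 1 := by
  unfold GM
  calc _ ≤ ∫⁻ x, ∫⁻ y, 1 ∂G ∂F := lintegral_mono fun x => lintegral_mono fun y => by
          simpa using gk_le_one ht x y
    _ = 1 := by simp

lemma GM_compl {d : ℕ} {t : ℝ} (ht : 0 < t) (F G : Measure (Fin d → ℝ))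
    [IsProbabilityMeasure F] [IsProbabilityMeasure G] :
    ∫⁻ x, ∫⁻ y, ENNReal.ofReal (1 - gk t x y) ∂G ∂F = 1 - GM t F G := by
  have hm := gk_meas (d := d) t
  have hle : ∀ x, ∫⁻ y, ENNReal.ofReal (gk t x y) ∂G ≤ 1 := fun x => by
    calc _ ≤ ∫⁻ y, 1 ∂G := lintegral_mono fun y => by simpa using gk_le_one ht x y
      _ = 1 := by simp
  have h1 : ∀ x, ∫⁻ y, ENNReal.ofReal (1 - gk t x y) ∂G =
      1 - ∫⁻ y, ENNReal.ofReal (gk t x y) ∂G := by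
    intro x
    simp_rw [ENNReal.ofReal_sub 1 (show 0 ≤ gk t x _ from (Real.exp_pos _).le)]
    have hmx : Measurable fun y => ENNReal.ofReal (gk t x y) :=
      gk_meas1 _ measurable_const measurable_id
    rw [lintegral_sub hmx
      (ne_top_of_le_ne_top ENNReal.one_ne_top (hle x))
      (ae_of_all _ fun y => ENNReal.ofReal_le_ofReal (gk_le_one ht x y))]
    simp
  simp_rw [h1]
  rw [lintegral_sub (Measurable.lintegral_prod_right' hm)
    (ne_top_of_le_ne_top ENNReal.one_ne_top (GM_le_one ht F G)) (ae_of_all _ hle)]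
  simp [GM]

lemma compl_ineq {d : ℕ} {t : ℝ} (ht : 0 < t) (F G : Measure (Fin d → ℝ))
    [IsProbabilityMeasure F] [IsProbabilityMeasure G] :
    (1 - GM t F F) + (1 - GM t G G) ≤ 2 * (1 - GM t F G) := by
  have h := GM_psd ht F G
  have h1 := GM_le_one ht F F
  have h2 := GM_le_one ht G G
  have h3 := GM_le_one ht F G
  generalize GM t F F = a at *
  generalize GM t G G = b at *
  generalize GM t F G = c at *
  lift a to NNReal using ne_top_of_le_ne_top ENNReal.one_ne_top h1
  lift b to NNReal using ne_top_of_le_ne_top ENNReal.one_ne_top h2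
  lift c to NNReal using ne_top_of_le_ne_top ENNReal.one_ne_top h3
  norm_cast at *
  rw [← NNReal.coe_le_coe] at *
  push_cast [NNReal.coe_sub h1, NNReal.coe_sub h2, NNReal.coe_sub h3] at *
  linarith

/-- The integrand of the subordination formula. -/
noncomputable def sub0 (p r t : ℝ) : ℝ := (1 - Real.exp (-(t * r))) * t ^ (-1 - p)

lemma sub0_nonneg {p r t : ℝ} (hr : 0 ≤ r) (ht : 0 < t) : 0 ≤ sub0 p r t := by
  unfold sub0
  refine mul_nonneg ?_ (Real.rpow_nonneg ht.le _)
  have : Real.exp (-(t * r)) ≤ 1 := by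
    rw [Real.exp_le_one_iff]; have := mul_nonneg ht.le hr; linarith
  linarith

lemma sub0_meas (p : ℝ) : Measurable (fun q : ℝ × ℝ => sub0 p q.1 q.2) := by
  unfold sub0; fun_prop

lemma sub0_integrable {p : ℝ} (hp : 0 < p) (hp1 : p < 1) :
    IntegrableOn (sub0 p 1) (Ioi 0) := by
  rw [← Ioc_union_Ioi_eq_Ioi zero_le_one]
  have hm : Measurable (sub0 p 1) := (sub0_meas p).comp measurable_prodMk_left
  refine IntegrableOn.union ?_ ?_
  · have h : IntegrableOn (fun t : ℝ => t ^ (-p)) (Ioc 0 1) := by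
      rw [← intervalIntegrable_iff_integrableOn_Ioc_of_le zero_le_one]
      exact intervalIntegral.intervalIntegrable_rpow' (by linarith)
    refine Integrable.mono' h hm.aestronglyMeasurable ?_
    filter_upwards [ae_restrict_mem measurableSet_Ioc] with t ht
    rw [Real.norm_of_nonneg (sub0_nonneg zero_le_one ht.1)]
    have : t ^ (-p) = t * t ^ (-1 - p) := by
      rw [← Real.rpow_one_add' ht.1.le (by linarith)]; congr 1; ring
    rw [this]
    unfold sub0
    refine mul_le_mul_of_nonneg_right ?_ (Real.rpow_nonneg ht.1.le _)
    have := Real.add_one_le_exp (-(t * 1))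
    linarith
  · have h : IntegrableOn (fun t : ℝ => t ^ (-1 - p)) (Ioi 1) :=
      integrableOn_Ioi_rpow_of_lt (by linarith) zero_lt_one
    refine Integrable.mono' h hm.aestronglyMeasurable ?_
    filter_upwards [ae_restrict_mem measurableSet_Ioi] with t ht
    have ht0 : (0:ℝ) < t := zero_lt_one.trans ht
    rw [Real.norm_of_nonneg (sub0_nonneg zero_le_one ht0)]
    unfold sub0
    refine mul_le_of_le_one_left (Real.rpow_nonneg ht0.le _) ?_
    have := Real.exp_pos (-(t * 1))
    linarith

lemma sub0_scale {p r t : ℝ} (hr : 0 < r) (ht : 0 < t) :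
    sub0 p r t = r ^ (1 + p) * sub0 p 1 (r * t) := by
  unfold sub0
  rw [Real.mul_rpow hr.le ht.le, mul_one, mul_comm r t]
  have : r ^ (1 + p) * r ^ (-1 - p) = 1 := by
    rw [← Real.rpow_add hr]; ring_nf; exact Real.rpow_zero r
  linear_combination (-(1 - Real.exp (-(t * r))) * t ^ (-1 - p)) * this

lemma sub0_lintegral {p : ℝ} (hp : 0 < p) (hp1 : p < 1) {r : ℝ} (hr : 0 ≤ r) :
    ∫⁻ t in Ioi (0:ℝ), ENNReal.ofReal (sub0 p r t) =
      ENNReal.ofReal (r ^ p) * ENNReal.ofReal (∫ t in Ioi (0:ℝ), sub0 p 1 t) := by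
  rcases hr.eq_or_lt with rfl | hr
  · simp [sub0, Real.zero_rpow hp.ne']
  have hi := sub0_integrable hp hp1
  have hi2 : IntegrableOn (fun t => sub0 p 1 (r * t)) (Ioi 0) := by
    rw [integrableOn_Ioi_comp_mul_left_iff _ _ hr]; simpa using hi
  have e : ∫⁻ t in Ioi (0:ℝ), ENNReal.ofReal (sub0 p r t) =
      ∫⁻ t in Ioi (0:ℝ), ENNReal.ofReal (r ^ (1 + p) * sub0 p 1 (r * t)) :=
    setLIntegral_congr_fun measurableSet_Ioi fun t ht => by
      simp only [sub0_scale (p := p) hr ht]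
  rw [e, ← ofReal_integral_eq_lintegral_ofReal (hi2.const_mul _), integral_const_mul,
    integral_comp_mul_left_Ioi _ _ hr, ← ENNReal.ofReal_mul (Real.rpow_nonneg hr.le _)]
  · rw [mul_zero, smul_eq_mul, ← mul_assoc, Real.rpow_add hr, Real.rpow_one]
    congr 2
    field_simp
  · filter_upwards [ae_restrict_mem measurableSet_Ioi] with t ht
    exact mul_nonneg (Real.rpow_nonneg hr.le _) (sub0_nonneg zero_le_one (mul_pos hr ht))

lemma sub0_pos {p : ℝ} (hp : 0 < p) (hp1 : p < 1) : 0 < ∫ t in Ioi (0:ℝ), sub0 p 1 t := by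
  rw [setIntegral_pos_iff_support_of_nonneg_ae _ (sub0_integrable hp hp1)]
  · have : Function.support (sub0 p 1) ∩ Ioi 0 = Ioi 0 := by
      rw [Set.inter_eq_right]
      intro t ht
      have ht : 0 < t := ht
      have : Real.exp (-(t * 1)) < 1 := by rw [Real.exp_lt_one_iff]; linarith
      exact (mul_pos (by linarith) (Real.rpow_pos_of_pos ht _)).ne'
    rw [this]; simp
  · filter_upwards [ae_restrict_mem measurableSet_Ioi] with t ht
    exact sub0_nonneg zero_le_one ht

/-- The energy functional as a lower integral. -/
noncomputable def EnL {d : ℕ} (β : ℝ) (F G : Measure (Fin d → ℝ)) : ℝ≥0∞ :=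
  ∫⁻ x, ∫⁻ y, ENNReal.ofReal (dist2 x y ^ β) ∂G ∂F

lemma EnL_eq {d : ℕ} {β : ℝ} (hβ1 : 1 ≤ β) (hβ2 : β < 2) (F G : Measure (Fin d → ℝ))
    [IsProbabilityMeasure F] [IsProbabilityMeasure G] :
    EnL β F G * ENNReal.ofReal (∫ t in Ioi (0:ℝ), sub0 (β / 2) 1 t) =
      ∫⁻ t in Ioi (0:ℝ), (1 - GM t F G) * ENNReal.ofReal (t ^ (-1 - β / 2)) := by
  have hp : 0 < β / 2 := by linarith
  have hp1 : β / 2 < 1 := by linarith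
  have hpt : ∀ x y : Fin d → ℝ, ENNReal.ofReal (dist2 x y ^ β) *
      ENNReal.ofReal (∫ t in Ioi (0:ℝ), sub0 (β / 2) 1 t) =
      ∫⁻ t in Ioi (0:ℝ), ENNReal.ofReal (sub0 (β / 2) (dist2 x y ^ 2) t) := by
    intro x y
    rw [sub0_lintegral hp hp1 (sq_nonneg _)]
    congr 2
    rw [← Real.rpow_natCast, ← Real.rpow_mul (dist2_nonneg' x y)]
    congr 1; push_cast; ring
  have hm : Measurable (fun p : (Fin d → ℝ) × (Fin d → ℝ) => ENNReal.ofReal (dist2 p.1 p.2 ^ β)) :=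
    (dist2_rpow_cont hβ1).measurable.ennreal_ofReal
  have hs : Measurable (fun q : ((Fin d → ℝ) × ℝ) × (Fin d → ℝ) =>
      ENNReal.ofReal (sub0 (β / 2) (dist2 q.1.1 q.2 ^ 2) q.1.2)) := by
    refine Measurable.ennreal_ofReal ?_
    have h1 : Measurable (fun q : ((Fin d → ℝ) × ℝ) × (Fin d → ℝ) => dist2 q.1.1 q.2) :=
      dist2_meas (by fun_prop) (by fun_prop)
    unfold sub0
    fun_prop
  calc _ = ∫⁻ x, (∫⁻ y, (∫⁻ t in Ioi (0:ℝ),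
        ENNReal.ofReal (sub0 (β / 2) (dist2 x y ^ 2) t)) ∂G) ∂F := by
        unfold EnL
        rw [← lintegral_mul_const _ (Measurable.lintegral_prod_right' hm)]
        refine lintegral_congr fun x => ?_
        rw [← lintegral_mul_const _ (show Measurable fun y => ENNReal.ofReal (dist2 x y ^ β) from
          ((dist2_meas measurable_const measurable_id).pow_const β).ennreal_ofReal)]
        exact lintegral_congr fun y => hpt x y
    _ = ∫⁻ x, (∫⁻ t in Ioi (0:ℝ), (∫⁻ y,
        ENNReal.ofReal (sub0 (β / 2) (dist2 x y ^ 2) t) ∂G)) ∂F := by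
        refine lintegral_congr fun x => ?_
        refine lintegral_lintegral_swap (Measurable.aemeasurable ?_)
        refine Measurable.ennreal_ofReal ?_
        have h1 : Measurable (fun q : (Fin d → ℝ) × ℝ => dist2 x q.1) :=
          dist2_meas (by fun_prop) (by fun_prop)
        unfold sub0
        fun_prop
    _ = ∫⁻ t in Ioi (0:ℝ), ∫⁻ x, ∫⁻ y,
        ENNReal.ofReal (sub0 (β / 2) (dist2 x y ^ 2) t) ∂G ∂F :=
        lintegral_lintegral_swap (Measurable.lintegral_prod_right' hs).aemeasurable
    _ = _ := by
        refine setLIntegral_congr_fun measurableSet_Ioi fun t ht => ?_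
        have ht : 0 < t := ht
        have hk : Measurable (fun p : (Fin d → ℝ) × (Fin d → ℝ) =>
          ENNReal.ofReal (1 - gk t p.1 p.2)) :=
            (measurable_const.sub
              (gk_meas0 measurable_const measurable_fst measurable_snd)).ennreal_ofReal
        rw [← GM_compl ht, ← lintegral_mul_const _ (Measurable.lintegral_prod_right' hk)]
        refine lintegral_congr fun x => ?_
        rw [← lintegral_mul_const _ (show Measurable fun y => ENNReal.ofReal (1 - gk t x y) from
          (measurable_const.sub
              (gk_meas0 measurable_const measurable_const measurable_id)).ennreal_ofReal)]
        refine lintegral_congr fun y => ?_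
        have : 0 ≤ 1 - gk t x y := by linarith [gk_le_one ht x y]
        rw [← ENNReal.ofReal_mul this]
        rfl

lemma EnL_ineq {d : ℕ} {β : ℝ} (hβ1 : 1 ≤ β) (hβ2 : β < 2) (F G : Measure (Fin d → ℝ))
    [IsProbabilityMeasure F] [IsProbabilityMeasure G] :
    EnL β F F + EnL β G G ≤ 2 * EnL β F G := by
  have hc : ENNReal.ofReal (∫ t in Ioi (0:ℝ), sub0 (β / 2) 1 t) ≠ 0 := by
    simpa using sub0_pos (p := β / 2) (by linarith) (by linarith)
  rw [← ENNReal.mul_le_mul_iff_left hc ENNReal.ofReal_ne_top, add_mul, mul_assoc,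
    EnL_eq hβ1 hβ2, EnL_eq hβ1 hβ2, EnL_eq hβ1 hβ2]
  have hm : ∀ F G : Measure (Fin d → ℝ), IsProbabilityMeasure F → IsProbabilityMeasure G →
      Measurable fun t => (1 - GM t F G) * ENNReal.ofReal (t ^ (-1 - β / 2)) := by
    intro F G _ _
    have : Measurable fun t => GM t F G := by
      unfold GM
      refine Measurable.lintegral_prod_right'
        (f := fun q : ℝ × (Fin d → ℝ) => ∫⁻ y, ENNReal.ofReal (gk q.1 q.2 y) ∂G) ?_
      refine Measurable.lintegral_prod_right'
        (f := fun q : (ℝ × (Fin d → ℝ)) × (Fin d → ℝ) => ENNReal.ofReal (gk q.1.1 q.1.2 q.2)) ?_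
      refine Measurable.ennreal_ofReal ?_
      exact gk_meas0 (by fun_prop) (by fun_prop) (by fun_prop)
    fun_prop
  rw [← lintegral_add_left (hm F F inferInstance inferInstance),
    ← lintegral_const_mul _ (hm F G inferInstance inferInstance)]
  refine setLIntegral_mono' measurableSet_Ioi fun t ht => ?_
  rw [← add_mul, ← mul_assoc]
  exact mul_le_mul_left (compl_ineq ht F G) _

lemma EnL_eq_Sb {d : ℕ} {β : ℝ} (hβ : 1 ≤ β) (F G : Measure (Fin d → ℝ))
    [IsProbabilityMeasure F] [IsProbabilityMeasure G]
    (hF : Integrable (fun x => euclNorm x ^ β) F) (hG : Integrable (fun x => euclNorm x ^ β) G) :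
    EnL β F G = ENNReal.ofReal (Sb d β F G) := by
  have h := integrable_pair hβ F G hF hG
  unfold EnL Sb
  rw [← integral_prod _ h, ofReal_integral_eq_lintegral_ofReal h
    (ae_of_all _ fun p => Real.rpow_nonneg (dist2_nonneg' _ _) _),
    lintegral_prod _ h.aemeasurable.ennreal_ofReal]

lemma Sb_nonneg {d : ℕ} (β : ℝ) (F G : Measure (Fin d → ℝ)) : 0 ≤ Sb d β F G :=
  integral_nonneg fun _ => integral_nonneg fun _ => Real.rpow_nonneg (dist2_nonneg' _ _) _

lemma energy_ineq {d : ℕ} {β : ℝ} (hβ1 : 1 ≤ β) (hβ2 : β < 2) (F G : Measure (Fin d → ℝ))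
    [IsProbabilityMeasure F] [IsProbabilityMeasure G]
    (hF : Integrable (fun x => euclNorm x ^ β) F) (hG : Integrable (fun x => euclNorm x ^ β) G) :
    Sb d β F F + Sb d β G G ≤ 2 * Sb d β F G := by
  have h := EnL_ineq hβ1 hβ2 F G
  rw [EnL_eq_Sb hβ1 F F hF hF, EnL_eq_Sb hβ1 G G hG hG, EnL_eq_Sb hβ1 F G hF hG,
    ← ENNReal.ofReal_add (Sb_nonneg _ _ _) (Sb_nonneg _ _ _),
    ← ENNReal.ofReal_ofNat 2, ← ENNReal.ofReal_mul (by norm_num),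
    ENNReal.ofReal_le_ofReal_iff (mul_nonneg (by norm_num) (Sb_nonneg _ _ _))] at h
  exact h

lemma integral_mix {d : ℕ} (F G : Measure (Fin d → ℝ)) {a : ℝ} (h0 : 0 < a) (h1 : a < 1)
    (f : (Fin d → ℝ) → ℝ) (hF : Integrable f F) (hG : Integrable f G) :
    ∫ x, f x ∂(ENNReal.ofReal a • F + ENNReal.ofReal (1 - a) • G) =
      a * ∫ x, f x ∂F + (1 - a) * ∫ x, f x ∂G := by
  rw [integral_add_measure (hF.smul_measure ENNReal.ofReal_ne_top)
    (hG.smul_measure ENNReal.ofReal_ne_top), integral_smul_measure, integral_smul_measure,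
    ENNReal.toReal_ofReal h0.le, ENNReal.toReal_ofReal (by linarith)]
  rfl

lemma Sb_comm' {d : ℕ} {β : ℝ} (hβ : 1 ≤ β) (F G : Measure (Fin d → ℝ))
    [IsProbabilityMeasure F] [IsProbabilityMeasure G]
    (hF : Integrable (fun x => euclNorm x ^ β) F) (hG : Integrable (fun x => euclNorm x ^ β) G) :
    Sb d β F G = Sb d β G F := by
  unfold Sb
  rw [integral_integral_swap (integrable_pair hβ F G hF hG)]
  simp_rw [dist2_comm']

lemma Sb_mix {d : ℕ} {β : ℝ} (hβ : 1 ≤ β) (F G : Measure (Fin d → ℝ))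
    [IsProbabilityMeasure F] [IsProbabilityMeasure G]
    (hF : Integrable (fun x => euclNorm x ^ β) F) (hG : Integrable (fun x => euclNorm x ^ β) G)
    {a : ℝ} (h0 : 0 < a) (h1 : a < 1) :
    Sb d β (ENNReal.ofReal a • F + ENNReal.ofReal (1 - a) • G)
      (ENNReal.ofReal a • F + ENNReal.ofReal (1 - a) • G) =
    a * (a * Sb d β F F + (1 - a) * Sb d β F G) +
      (1 - a) * (a * Sb d β G F + (1 - a) * Sb d β G G) := by
  have hr : ∀ F : Measure (Fin d → ℝ), IsProbabilityMeasure F →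
      Integrable (fun x => euclNorm x ^ β) F → ∀ x, Integrable (fun y => dist2 x y ^ β) F := by
    intro F _ hF x
    simp_rw [dist2_comm' x]
    exact integrable_left hβ F hF x
  have iFF : Integrable (fun x => ∫ y, dist2 x y ^ β ∂F) F := (integrable_pair hβ F F hF hF).integral_prod_left
  have iFG : Integrable (fun x => ∫ y, dist2 x y ^ β ∂G) F := (integrable_pair hβ F G hF hG).integral_prod_left
  have iGF : Integrable (fun x => ∫ y, dist2 x y ^ β ∂F) G := (integrable_pair hβ G F hG hF).integral_prod_left
  have iGG : Integrable (fun x => ∫ y, dist2 x y ^ β ∂G) G := (integrable_pair hβ G G hG hG).integral_prod_left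
  have hin : ∀ x, ∫ y, dist2 x y ^ β ∂(ENNReal.ofReal a • F + ENNReal.ofReal (1 - a) • G) =
      a * ∫ y, dist2 x y ^ β ∂F + (1 - a) * ∫ y, dist2 x y ^ β ∂G := fun x =>
    integral_mix F G h0 h1 _ (hr F inferInstance hF x) (hr G inferInstance hG x)
  unfold Sb
  simp_rw [hin]
  rw [integral_mix F G h0 h1 (fun x => a * ∫ y, dist2 x y ^ β ∂F + (1 - a) * ∫ y, dist2 x y ^ β ∂G)
    ((iFF.const_mul a).add (iFG.const_mul (1 - a)))
    ((iGF.const_mul a).add (iGG.const_mul (1 - a))),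
    integral_add (iFF.const_mul a) (iFG.const_mul (1 - a)),
    integral_add (iGF.const_mul a) (iGG.const_mul (1 - a))]
  simp only [integral_const_mul]

/-- for `β ∈ [1,2)`, (i) `y ↦ ES_β(F,y)` is convex on `ℝ^d`, and
(ii) `F ↦ ES_β(F,y)` is convex under mixtures. -/
theorem stmt17 (d : ℕ) (β : ℝ) (hβ1 : 1 ≤ β) (hβ2 : β < 2) :
    (∀ F : Measure (Fin d → ℝ), IsProbabilityMeasure F →
      Integrable (fun x => euclNorm x ^ β) F →
      ConvexOn ℝ Set.univ (fun y => ES d β F y)) ∧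
    (∀ y : Fin d → ℝ, ∀ F G : Measure (Fin d → ℝ),
      IsProbabilityMeasure F → IsProbabilityMeasure G →
      Integrable (fun x => euclNorm x ^ β) F → Integrable (fun x => euclNorm x ^ β) G →
      ∀ α : ℝ, 0 < α → α < 1 →
        ES d β (ENNReal.ofReal α • F + ENNReal.ofReal (1 - α) • G) y ≤
          α * ES d β F y + (1 - α) * ES d β G y) := by
  refine ⟨fun F hF hi => convex_part hβ1 F hi, fun y F G hF hG hiF hiG a h0 h1 => ?_⟩
  have hm : SbY d β (ENNReal.ofReal a • F + ENNReal.ofReal (1 - a) • G) y =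
      a * SbY d β F y + (1 - a) * SbY d β G y :=
    integral_mix F G h0 h1 _ (integrable_left hβ1 F hiF y) (integrable_left hβ1 G hiG y)
  have he := energy_ineq hβ1 hβ2 F G hiF hiG
  simp only [ES]
  rw [hm, Sb_mix hβ1 F G hiF hiG h0 h1, Sb_comm' hβ1 G F hiG hiF]
  have := mul_le_mul_of_nonneg_left he (mul_nonneg h0.le (sub_nonneg.2 h1.le))
  linarith
end
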